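/- arXiv:2103.13066 — 2 statements merged into one kernel-verified Lean document; each statement's English description precedes it below -/
import Mathlib

section
/- There exists a constant C > 0 such that for every natural number M there is a finite set A of positive integers with |A| ≥ M and max{t₊(A), tˣ(A)} ≤ C·|A|^{5/6}. -/
open Finset

/-- `EAdd A` is the number of ordered quadruples `(a,b,c,d) ∈ A⁴` with `a + b = c + d`. -/
def EAdd (A : Finset ℕ) : ℕ :=
  ((A ×ˢ A ×ˢ A ×ˢ A).filter fun x => x.1 + x.2.1 = x.2.2.1 + x.2.2.2).card

/-- `EMul A` is the number of ordered quadruples `(a,b,c,d) ∈ A⁴` with `a * b = c * d`. -/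
def EMul (A : Finset ℕ) : ℕ :=
  ((A ×ˢ A ×ˢ A ×ˢ A).filter fun x => x.1 * x.2.1 = x.2.2.1 * x.2.2.2).card

/-- `tAdd A` is the size of the largest subset `A' ⊆ A` with `E₊(A') < 2|A'|²`. -/
def tAdd (A : Finset ℕ) : ℕ :=
  (A.powerset.filter fun S => EAdd S < 2 * S.card ^ 2).sup Finset.card

/-- `tMul A` is the size of the largest subset `A' ⊆ A` with `Eˣ(A') < 2|A'|²`. -/
def tMul (A : Finset ℕ) : ℕ :=
  (A.powerset.filter fun S => EMul S < 2 * S.card ^ 2).sup Finset.card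

/-- The energy of `S` with respect to `op` is the sum of the squared representation counts. -/
lemma card_filter_quadruple_eq_sum_sq (S W : Finset ℕ) (op : ℕ → ℕ → ℕ)
    (hW : ∀ a ∈ S, ∀ b ∈ S, op a b ∈ W) :
    ((S ×ˢ S ×ˢ S ×ˢ S).filter fun x => op x.1 x.2.1 = op x.2.2.1 x.2.2.2).card =
      ∑ v ∈ W, ((S ×ˢ S).filter fun p => op p.1 p.2 = v).card ^ 2 := by
  rw [card_eq_sum_card_fiberwise (f := fun x => op x.1 x.2.1) (t := W)]
  · refine sum_congr rfl fun v _ => ?_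
    rw [sq, ← card_product]
    refine card_bij' (fun x _ => ((x.1, x.2.1), x.2.2)) (fun y _ => (y.1.1, y.1.2, y.2))
      ?_ ?_ ?_ ?_
    · simp only [mem_filter, mem_product]
      rintro x ⟨⟨⟨h₁, h₂, h₃, h₄⟩, h⟩, rfl⟩
      exact ⟨⟨⟨h₁, h₂⟩, rfl⟩, ⟨h₃, h₄⟩, h.symm⟩
    · simp only [mem_filter, mem_product]
      rintro x ⟨⟨⟨h₁, h₂⟩, rfl⟩, ⟨h₃, h₄⟩, h⟩
      exact ⟨⟨⟨h₁, h₂, h₃, h₄⟩, h.symm⟩, rfl⟩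
    · simp
    · simp
  · intro x hx
    simp only [coe_filter, Set.mem_ofPred_eq, mem_product] at hx
    exact hW _ hx.1.1 _ hx.1.2.1

/-- By Cauchy–Schwarz, a colouring with few colours has many monochromatic pairs. -/
lemma card_sq_le_card_mul_card_filter (S J : Finset ℕ) (g : ℕ → ℕ) (hg : ∀ a ∈ S, g a ∈ J) :
    S.card ^ 2 ≤ J.card * ((S ×ˢ S).filter fun p => g p.1 = g p.2).card := by
  have hT : ((S ×ˢ S).filter fun p => g p.1 = g p.2).card =
      ∑ j ∈ J, (S.filter fun a => g a = j).card ^ 2 := by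
    rw [card_eq_sum_card_fiberwise (f := fun p => g p.1) (t := J)]
    · refine sum_congr rfl fun j _ => ?_
      rw [sq, ← card_product]
      congr 1
      ext p
      simp only [mem_filter, mem_product]
      grind
    · intro p hp
      simp only [coe_filter, Set.mem_ofPred_eq, mem_product] at hp
      exact hg _ hp.1.1
  rw [hT, card_eq_sum_card_fiberwise (f := g) (t := J) fun a ha => hg a ha]
  exact sq_sum_le_card_mul_sum_sq

/-- If `S` has nearly minimal energy for a commutative operation `op`, and pairs in `S` having the
same colour under `g` take values in `V`, then `S` is small. -/
lemma card_sq_le_of_energy_lt (S J V : Finset ℕ) (op : ℕ → ℕ → ℕ) (g : ℕ → ℕ)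
    (hcomm : ∀ a b, op a b = op b a) (hg : ∀ a ∈ S, g a ∈ J)
    (hV : ∀ a ∈ S, ∀ b ∈ S, g a = g b → op a b ∈ V)
    (hE : ((S ×ˢ S ×ˢ S ×ˢ S).filter fun x => op x.1 x.2.1 = op x.2.2.1 x.2.2.2).card <
      2 * S.card ^ 2) :
    S.card ^ 2 ≤ J.card * (2 * V.card) := by
  refine (card_sq_le_card_mul_card_filter S J g hg).trans (Nat.mul_le_mul_left _ ?_)
  set r : ℕ → ℕ := fun v => ((S ×ˢ S).filter fun p => op p.1 p.2 = v).card
  set W := V ∪ (S ×ˢ S).image fun p => op p.1 p.2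
  have hW : ∀ a ∈ S, ∀ b ∈ S, op a b ∈ W := fun a ha b hb =>
    mem_union_right _ (mem_image.2 ⟨(a, b), mem_product.2 ⟨ha, hb⟩, rfl⟩)
  have hTV : ((S ×ˢ S).filter fun p => g p.1 = g p.2).card ≤ ∑ v ∈ V, r v := by
    rw [card_eq_sum_card_fiberwise (f := fun p => op p.1 p.2) (t := V)]
    · refine sum_le_sum fun v _ => card_le_card fun p hp => ?_
      simp only [mem_filter] at hp ⊢
      exact ⟨hp.1.1, hp.2⟩
    · intro p hp
      simp only [coe_filter, Set.mem_ofPred_eq, mem_product] at hp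
      exact hV _ hp.1.1 _ hp.1.2 hp.2
  have hs : S.card ^ 2 = ∑ v ∈ W, r v := by
    rw [sq, ← card_product]
    refine card_eq_sum_card_fiberwise fun p hp => ?_
    rw [mem_coe, mem_product] at hp
    exact hW _ hp.1 _ hp.2
  rw [card_filter_quadruple_eq_sum_sq S W op hW, hs] at hE
  have hoff : ∀ v ∉ V, r v ≠ 1 := by
    intro v hv h1
    obtain ⟨⟨a, b⟩, hab⟩ := card_eq_one.1 h1
    have hmem : (a, b) ∈ (S ×ˢ S).filter fun p => op p.1 p.2 = v := by simp [hab]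
    simp only [mem_filter, mem_product] at hmem
    have hswap : (b, a) ∈ (S ×ˢ S).filter fun p => op p.1 p.2 = v := by
      simp only [mem_filter, mem_product]
      exact ⟨hmem.1.symm, hcomm a b ▸ hmem.2⟩
    rw [hab, mem_singleton, Prod.mk.injEq] at hswap
    exact hv (hmem.2 ▸ hV _ hmem.1.1 _ hmem.1.2 (by rw [hswap.1]))
  have hdisj : ∑ v ∈ W \ V, 2 * r v ≤ ∑ v ∈ W \ V, r v ^ 2 := by
    refine sum_le_sum fun v hv => ?_
    have h1 := hoff v (mem_sdiff.1 hv).2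
    rcases Nat.lt_or_ge (r v) 2 with h | h
    · have h0 : r v = 0 := by omega
      simp [h0]
    · rw [sq]
      exact Nat.mul_le_mul_right _ h
  have hon : ∑ v ∈ V, 4 * r v ≤ ∑ v ∈ V, (r v ^ 2 + 4) := by
    refine sum_le_sum fun v _ => ?_
    zify
    nlinarith [sq_nonneg ((r v : ℤ) - 2)]
  have hVW : V ⊆ W := subset_union_left
  rw [← sum_sdiff hVW, ← sum_sdiff hVW] at hE
  simp only [← mul_sum, sum_add_distrib, sum_const, smul_eq_mul] at hdisj hon
  change ∑ v ∈ W \ V, r v ^ 2 + ∑ v ∈ V, r v ^ 2 < _ at hE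
  omega

/-- The set of all `(2i+1)·2^j` with `i, j < k`. -/
def oddTimesPow (k : ℕ) : Finset ℕ :=
  (range k ×ˢ range k).image fun p => (2 * p.1 + 1) * 2 ^ p.2

lemma mem_oddTimesPow {k a : ℕ} :
    a ∈ oddTimesPow k ↔ ∃ i < k, ∃ j < k, (2 * i + 1) * 2 ^ j = a := by
  simp only [oddTimesPow, mem_image, mem_product, mem_range, Prod.exists]
  grind

lemma factorization_two_odd_mul_pow (i j : ℕ) :
    ((2 * i + 1) * 2 ^ j).factorization 2 = j := by
  have h : (2 * i + 1).factorization 2 = 0 := Nat.factorization_eq_zero_of_not_dvd (by omega)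
  rw [Nat.factorization_mul (by omega) (by positivity), Finsupp.add_apply, h,
    Nat.prime_two.factorization_pow]
  simp

lemma card_oddTimesPow (k : ℕ) : (oddTimesPow k).card = k ^ 2 := by
  rw [oddTimesPow, card_image_of_injective, card_product, card_range, sq]
  rintro ⟨i, j⟩ ⟨i', j'⟩ h
  have hj := congrArg (fun n => Nat.factorization n 2) h
  simp only [factorization_two_odd_mul_pow] at hj
  subst hj
  have := Nat.eq_of_mul_eq_mul_right (by positivity) h
  simp only [Prod.mk.injEq, and_true]
  omega

lemma sup_card_sq_le {A : Finset ℕ} {N : ℕ} (E : Finset ℕ → ℕ)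
    (h : ∀ S ⊆ A, E S < 2 * S.card ^ 2 → S.card ^ 2 ≤ N) :
    ((A.powerset.filter fun S => E S < 2 * S.card ^ 2).sup Finset.card) ^ 2 ≤ N := by
  refine Finset.sup_induction (p := fun n => n ^ 2 ≤ N) (by simp) ?_ ?_
  · intro a ha b hb
    rcases max_choice a b with h | h <;> simp_all
  · intro S hS
    rw [mem_filter, mem_powerset] at hS
    exact h S hS.1 hS.2

lemma tAdd_oddTimesPow_sq_le (k : ℕ) : tAdd (oddTimesPow k) ^ 2 ≤ 4 * k ^ 3 := by
  have key : ∀ S ⊆ oddTimesPow k, EAdd S < 2 * S.card ^ 2 → S.card ^ 2 ≤ 4 * k ^ 3 := by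
    intro S hS hE
    have h := card_sq_le_of_energy_lt S (range k)
      ((range (2 * k) ×ˢ range k).image fun p => (2 * p.1 + 2) * 2 ^ p.2) (· + ·)
      (fun a => a.factorization 2) add_comm ?_ ?_ hE
    · have hc := card_image_le (s := range (2 * k) ×ˢ range k)
        (f := fun p => (2 * p.1 + 2) * 2 ^ p.2)
      rw [card_product, card_range, card_range] at hc
      rw [card_range] at h
      calc S.card ^ 2 ≤ _ := h
        _ ≤ k * (2 * (2 * k * k)) := by gcongr
        _ = 4 * k ^ 3 := by ring
    · intro a ha
      obtain ⟨i, hi, j, hj, rfl⟩ := mem_oddTimesPow.1 (hS ha)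
      simpa only [factorization_two_odd_mul_pow, mem_range] using hj
    · intro a ha b hb hab
      obtain ⟨i, hi, j, hj, rfl⟩ := mem_oddTimesPow.1 (hS ha)
      obtain ⟨i', hi', j', hj', rfl⟩ := mem_oddTimesPow.1 (hS hb)
      simp only [factorization_two_odd_mul_pow] at hab
      subst hab
      refine mem_image.2 ⟨(i + i', j), ?_, by ring⟩
      simp only [mem_product, mem_range]
      omega
  exact sup_card_sq_le EAdd key

lemma tMul_oddTimesPow_sq_le (k : ℕ) : tMul (oddTimesPow k) ^ 2 ≤ 4 * k ^ 3 := by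
  have key : ∀ S ⊆ oddTimesPow k, EMul S < 2 * S.card ^ 2 → S.card ^ 2 ≤ 4 * k ^ 3 := by
    have hodd : ∀ i j : ℕ, (2 * i + 1) * 2 ^ j /
        2 ^ ((2 * i + 1) * 2 ^ j).factorization 2 / 2 = i := by
      intro i j
      rw [factorization_two_odd_mul_pow, Nat.mul_div_cancel _ (by positivity)]
      omega
    intro S hS hE
    have h := card_sq_le_of_energy_lt S (range k)
      ((range (2 * k) ×ˢ range k).image fun p => (2 * p.2 + 1) ^ 2 * 2 ^ p.1) (· * ·)
      (fun a => a / 2 ^ a.factorization 2 / 2) mul_comm ?_ ?_ hE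
    · have hc := card_image_le (s := range (2 * k) ×ˢ range k)
        (f := fun p => (2 * p.2 + 1) ^ 2 * 2 ^ p.1)
      rw [card_product, card_range, card_range] at hc
      rw [card_range] at h
      calc S.card ^ 2 ≤ _ := h
        _ ≤ k * (2 * (2 * k * k)) := by gcongr
        _ = 4 * k ^ 3 := by ring
    · intro a ha
      obtain ⟨i, hi, j, hj, rfl⟩ := mem_oddTimesPow.1 (hS ha)
      simpa only [hodd, mem_range] using hi
    · intro a ha b hb hab
      obtain ⟨i, hi, j, hj, rfl⟩ := mem_oddTimesPow.1 (hS ha)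
      obtain ⟨i', hi', j', hj', rfl⟩ := mem_oddTimesPow.1 (hS hb)
      simp only [hodd] at hab
      subst hab
      refine mem_image.2 ⟨(j + j', i), ?_, by ring⟩
      simp only [mem_product, mem_range]
      omega
  exact sup_card_sq_le EMul key

lemma le_two_mul_rpow_of_sq_le {k t : ℕ} (hk : 1 ≤ k) (h : t ^ 2 ≤ 4 * k ^ 3) :
    (t : ℝ) ≤ 2 * ((k ^ 2 : ℕ) : ℝ) ^ ((5 : ℝ) / 6) := by
  have hk' : (1 : ℝ) ≤ k := by exact_mod_cast hk
  have h' : (t : ℝ) ^ 2 ≤ 4 * (k : ℝ) ^ 3 := by exact_mod_cast h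
  refine le_of_sq_le_sq ?_ (by positivity)
  calc (t : ℝ) ^ 2 ≤ 4 * (k : ℝ) ^ (3 : ℝ) := by exact_mod_cast h'
    _ ≤ 4 * (k : ℝ) ^ ((10 : ℝ) / 3) := by
      gcongr
      norm_num
    _ = (2 * ((k ^ 2 : ℕ) : ℝ) ^ ((5 : ℝ) / 6)) ^ 2 := by
      have hk0 : (0 : ℝ) ≤ k := by positivity
      rw [mul_pow, Nat.cast_pow, ← Real.rpow_natCast (k : ℝ) 2, ← Real.rpow_mul hk0,
        ← Real.rpow_mul_natCast hk0]
      norm_num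

theorem stmt12 :
    ∃ C : ℝ, 0 < C ∧ ∀ M : ℕ, ∃ A : Finset ℕ,
      (∀ a ∈ A, 0 < a) ∧ M ≤ A.card ∧
      (max (tAdd A) (tMul A) : ℝ) ≤ C * (A.card : ℝ) ^ ((5 : ℝ) / 6) := by
  refine ⟨2, two_pos, fun M => ⟨oddTimesPow (M + 1), ?_, ?_, ?_⟩⟩
  · intro a ha
    obtain ⟨i, -, j, -, rfl⟩ := mem_oddTimesPow.1 ha
    positivity
  · rw [card_oddTimesPow]
    nlinarith
  · rw [card_oddTimesPow]
    exact max_le (le_two_mul_rpow_of_sq_le (by omega) (tAdd_oddTimesPow_sq_le _))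
      (le_two_mul_rpow_of_sq_le (by omega) (tMul_oddTimesPow_sq_le _))
end

section
/- There exists a constant C > 0 such that for every natural number N ≥ 1, the set A = {(2i−1)·2^j : 1 ≤ i ≤ N², 1 ≤ j ≤ N} has the property that every subset A' ⊆ A with |A'| ≥ C·N^{5/2} satisfies E₊(A') ≥ 2|A'|²; that is, t₊(A) ≤ C·N^{5/2} = C·|A|^{5/6}. -/
open Finset

open scoped Combinatorics.Additive in
theorem EAdd_eq_addEnergy (A : Finset ℕ) : EAdd A = E[A] := by
  rw [addEnergy_eq_card_filter]
  exact card_equiv (Equiv.prodAssoc ℕ ℕ (ℕ × ℕ)).symm (by simp [and_assoc])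

/-- The additive energy is superadditive over the fibres of a function. -/
theorem sum_EAdd_fiber_le {ι : Type*} [DecidableEq ι] (A : Finset ℕ) (f : ℕ → ι) (t : Finset ι) :
    ∑ j ∈ t, EAdd (A.filter fun a => f a = j) ≤ EAdd A := by
  unfold EAdd
  rw [← card_biUnion]
  · refine card_le_card fun x hx => ?_
    simp only [mem_biUnion, mem_filter, mem_product] at hx ⊢
    tauto
  · intro i _ j _ hij
    refine disjoint_left.2 fun x hx hy => hij ?_
    simp only [mem_filter, mem_product] at hx hy
    exact hx.1.1.2.symm.trans hy.1.1.2

/-- A Cauchy–Schwarz lower bound for the energy of a set all of whose pairwise sums lie in `U`. -/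
theorem card_pow_four_le_card_mul_EAdd (A U : Finset ℕ) (h : ∀ a ∈ A, ∀ b ∈ A, a + b ∈ U) :
    A.card ^ 4 ≤ U.card * EAdd A := by
  have key := card_sq_le_card_mul_addEnergy A A U
  rw [filter_true_of_mem, card_product, ← EAdd_eq_addEnergy] at key
  · calc A.card ^ 4 = (A.card * A.card) ^ 2 := by ring
      _ ≤ _ := key
  · rintro ⟨a, b⟩ hab
    exact h a (mem_product.1 hab).1 b (mem_product.1 hab).2

theorem sum_pow_four_le {ι : Type*} (t : Finset ι) (f : ι → ℕ) :
    (∑ j ∈ t, f j) ^ 4 ≤ t.card ^ 3 * ∑ j ∈ t, f j ^ 4 :=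
  calc (∑ j ∈ t, f j) ^ 4 = ((∑ j ∈ t, f j) ^ 2) ^ 2 := by ring
    _ ≤ (t.card * ∑ j ∈ t, f j ^ 2) ^ 2 := by
        gcongr
        exact sq_sum_le_card_mul_sum_sq
    _ = t.card ^ 2 * (∑ j ∈ t, f j ^ 2) ^ 2 := by ring
    _ ≤ t.card ^ 2 * (t.card * ∑ j ∈ t, (f j ^ 2) ^ 2) := by
        gcongr
        exact sq_sum_le_card_mul_sum_sq
    _ = t.card ^ 3 * ∑ j ∈ t, f j ^ 4 := by
        simp only [← pow_mul]
        ring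

theorem padicValNat_odd_mul_two_pow {i : ℕ} (hi : 1 ≤ i) (j : ℕ) :
    padicValNat 2 ((2 * i - 1) * 2 ^ j) = j := by
  rw [padicValNat.mul (by omega) (by positivity), padicValNat.prime_pow,
    padicValNat.eq_zero_of_not_dvd (by omega), zero_add]

/-- The grid of odd numbers below `2 M` times the powers `2, 4, …, 2 ^ N`. -/
def oddGrid (M N : ℕ) : Finset ℕ :=
  (Finset.Icc 1 M ×ˢ Finset.Icc 1 N).image fun x : ℕ × ℕ => (2 * x.1 - 1) * 2 ^ x.2

theorem card_oddGrid (M N : ℕ) : (oddGrid M N).card = M * N := by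
  rw [oddGrid, card_image_of_injOn, card_product, Nat.card_Icc, Nat.card_Icc]
  · simp
  · rintro ⟨i, j⟩ hx ⟨k, l⟩ hy h
    simp only [coe_product, Set.mem_prod, mem_coe, mem_Icc] at hx hy
    dsimp only at h
    obtain rfl : j = l := by
      rw [← padicValNat_odd_mul_two_pow hx.1.1 j, h, padicValNat_odd_mul_two_pow hy.1.1 l]
    have := Nat.eq_of_mul_eq_mul_right (by positivity) h
    ext <;> simp only
    omega

theorem mem_oddGrid_iff {M N a : ℕ} :
    a ∈ oddGrid M N ↔ ∃ i j, (1 ≤ i ∧ i ≤ M) ∧ (1 ≤ j ∧ j ≤ N) ∧ (2 * i - 1) * 2 ^ j = a := by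
  simp [oddGrid, and_assoc]

theorem card_pow_four_le_of_subset_oddGrid {M N : ℕ} {S : Finset ℕ} (hS : S ⊆ oddGrid M N) :
    S.card ^ 4 ≤ N ^ 3 * (2 * M) * EAdd S := by
  have hfib : ∀ j, (S.filter fun a => padicValNat 2 a = j).card ^ 4 ≤
      2 * M * EAdd (S.filter fun a => padicValNat 2 a = j) := by
    intro j
    refine (card_pow_four_le_card_mul_EAdd _
      ((Finset.Icc 1 (2 * M)).image fun m => m * 2 ^ (j + 1)) ?_).trans ?_
    · intro a ha b hb
      rw [mem_filter] at ha hb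
      obtain ⟨i, k, hi, -, rfl⟩ := mem_oddGrid_iff.1 (hS ha.1)
      obtain ⟨i', k', hi', -, rfl⟩ := mem_oddGrid_iff.1 (hS hb.1)
      obtain rfl := (padicValNat_odd_mul_two_pow hi.1 k).symm.trans ha.2
      obtain rfl := (padicValNat_odd_mul_two_pow hi'.1 k').symm.trans hb.2
      refine mem_image.2 ⟨i + i' - 1, mem_Icc.2 (by omega), ?_⟩
      rw [pow_succ', ← mul_assoc, ← add_mul]
      congr 1
      omega
    · gcongr
      exact card_image_le.trans (by simp)
  have hcard : S.card = ∑ j ∈ Finset.Icc 1 N, (S.filter fun a => padicValNat 2 a = j).card := by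
    refine card_eq_sum_card_fiberwise fun a ha => ?_
    obtain ⟨i, j, hi, hj, rfl⟩ := mem_oddGrid_iff.1 (hS ha)
    rw [padicValNat_odd_mul_two_pow hi.1]
    exact mem_coe.2 (mem_Icc.2 hj)
  calc S.card ^ 4
      ≤ (Finset.Icc 1 N).card ^ 3 *
          ∑ j ∈ Finset.Icc 1 N, (S.filter fun a => padicValNat 2 a = j).card ^ 4 := by
        rw [hcard]
        exact sum_pow_four_le _ _
    _ ≤ N ^ 3 * ∑ j ∈ Finset.Icc 1 N, 2 * M * EAdd (S.filter fun a => padicValNat 2 a = j) := by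
        rw [Nat.card_Icc, Nat.add_sub_cancel]
        gcongr
        exact hfib _
    _ ≤ N ^ 3 * (2 * M) * EAdd S := by
        rw [← mul_sum, ← mul_assoc]
        gcongr
        exact sum_EAdd_fiber_le _ _ _

theorem two_mul_card_sq_le_EAdd {N : ℕ} (hN : 1 ≤ N) {S : Finset ℕ} (hS : S ⊆ oddGrid (N ^ 2) N)
    (hcard : 4 * N ^ 5 ≤ S.card ^ 2) : 2 * S.card ^ 2 ≤ EAdd S := by
  have h := card_pow_four_le_of_subset_oddGrid hS
  have hpos : 0 < 2 * N ^ 5 := by positivity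
  refine le_of_mul_le_mul_left ?_ hpos
  calc 2 * N ^ 5 * (2 * S.card ^ 2) = 4 * N ^ 5 * S.card ^ 2 := by ring
    _ ≤ S.card ^ 2 * S.card ^ 2 := by gcongr
    _ = S.card ^ 4 := by ring
    _ ≤ _ := h
    _ = 2 * N ^ 5 * EAdd S := by ring

theorem stmt16 :
    ∃ C : ℝ, 0 < C ∧ ∀ N : ℕ, 1 ≤ N → ∀ A : Finset ℕ,
      A = ((Finset.Icc 1 (N ^ 2) ×ˢ Finset.Icc 1 N).image
          fun x : ℕ × ℕ => (2 * x.1 - 1) * 2 ^ x.2) →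
      (∀ A' ⊆ A, C * (N : ℝ) ^ ((5 : ℝ) / 2) ≤ (A'.card : ℝ) →
        2 * A'.card ^ 2 ≤ EAdd A') ∧
      (tAdd A : ℝ) ≤ C * (N : ℝ) ^ ((5 : ℝ) / 2) ∧
      C * (N : ℝ) ^ ((5 : ℝ) / 2) = C * (A.card : ℝ) ^ ((5 : ℝ) / 6) := by
  refine ⟨2, two_pos, fun N hN A hA => ?_⟩
  change A = oddGrid (N ^ 2) N at hA
  subst hA
  have hN0 : (0 : ℝ) ≤ N := Nat.cast_nonneg N
  have henergy : ∀ S ⊆ oddGrid (N ^ 2) N, 2 * (N : ℝ) ^ ((5 : ℝ) / 2) ≤ (S.card : ℝ) →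
      2 * S.card ^ 2 ≤ EAdd S := by
    intro S hS hcard
    refine two_mul_card_sq_le_EAdd hN hS ?_
    have hsq : ((N : ℝ) ^ ((5 : ℝ) / 2)) ^ 2 = (N : ℝ) ^ 5 := by
      rw [← Real.rpow_mul_natCast hN0, ← Real.rpow_natCast]
      norm_num
    have h := pow_le_pow_left₀ (by positivity) hcard 2
    rw [mul_pow, hsq] at h
    norm_num at h
    exact_mod_cast h
  refine ⟨henergy, ?_, ?_⟩
  · refine (Nat.cast_le.2 (Finset.sup_le fun S hS => Nat.le_floor ?_)).trans
      (Nat.floor_le (by positivity))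
    rw [mem_filter, mem_powerset] at hS
    by_contra! hlt
    exact absurd (henergy S hS.1 hlt.le) hS.2.not_ge
  · rw [card_oddGrid, ← pow_succ, Nat.cast_pow, ← Real.rpow_natCast, ← Real.rpow_mul hN0]
    norm_num
end
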